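/- arXiv:1607.03028 — 4 statements merged into one kernel-verified Lean document; each statement's English description precedes it below -/
import Mathlib

section
/- Assume Γ, E satisfy Hypothesis (S). Then there exists c > 0 such that for every ω ∈ ℝ and all u, v ∈ X, if (2πiωΓ − E) v = Γ u then (1 + |ω|)·‖v‖ ≤ c·‖u‖; equivalently, the operators (2πiωΓ − E)⁻¹∘Γ satisfy ‖(2πiωΓ − E)⁻¹∘Γ‖ ≤ c/(1 + |ω|) for all ω ∈ ℝ. -/
/-- Under Hypothesis (S) for `Γ, E`, there exists `c > 0` such
that for every `ω ∈ ℝ` and all `u, v ∈ X`, if `(2πiωΓ − E) v = Γ u` then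
`(1 + |ω|)·‖v‖ ≤ c·‖u‖`; i.e. `‖(2πiωΓ − E)⁻¹ ∘ Γ‖ ≤ c/(1 + |ω|)`. -/
theorem resolvent_comp_Gamma_decay
    {X : Type*} [NormedAddCommGroup X] [InnerProductSpace ℂ X] [CompleteSpace X]
    (Γ E : X →L[ℂ] X)
    (hΓ : IsSelfAdjoint Γ) (hΓinj : Function.Injective Γ)
    (hE : IsSelfAdjoint E) (hEbij : Function.Bijective E)
    (hbij : ∀ ω : ℝ,
      Function.Bijective ((((2 * Real.pi * ω : ℝ) : ℂ) * Complex.I) • Γ - E))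
    (M : ℝ) (hM : 0 < M)
    (hMbound : ∀ (ω : ℝ) (v : X),
      ‖v‖ ≤ M * ‖((((2 * Real.pi * ω : ℝ) : ℂ) * Complex.I) • Γ - E) v‖) :
    ∃ c : ℝ, 0 < c ∧ ∀ (ω : ℝ) (u v : X),
      ((((2 * Real.pi * ω : ℝ) : ℂ) * Complex.I) • Γ - E) v = Γ u →
        (1 + |ω|) * ‖v‖ ≤ c * ‖u‖ := by
  refine ⟨1 + M * ‖E‖ + M * ‖Γ‖, by positivity, fun ω u v h => ?_⟩
  have hv : ‖v‖ ≤ M * (‖Γ‖ * ‖u‖) :=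
    (hMbound ω v).trans (by rw [h]; gcongr; exact Γ.le_opNorm u)
  set z : ℂ := ((2 * Real.pi * ω : ℝ) : ℂ) * Complex.I with hz
  have key : (z • Γ - E) (z • v - u) = E u := by
    rw [map_sub, map_smul, h]
    simp
  have hzvu : ‖z • v - u‖ ≤ M * (‖E‖ * ‖u‖) :=
    (hMbound ω _).trans (by rw [key]; gcongr; exact E.le_opNorm u)
  have hzv : ‖z‖ * ‖v‖ ≤ ‖u‖ + M * (‖E‖ * ‖u‖) := by
    rw [← norm_smul]
    linarith [norm_sub_norm_le (z • v) u]
  have hωz : |ω| ≤ ‖z‖ := by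
    rw [hz, norm_mul, Complex.norm_I, mul_one, Complex.norm_real, Real.norm_eq_abs, abs_mul,
      abs_of_pos Real.two_pi_pos]
    exact le_mul_of_one_le_left (abs_nonneg ω) (by linarith [Real.pi_gt_three])
  linarith [mul_le_mul_of_nonneg_right hωz (norm_nonneg v)]
end

section
/- (Theorem on invertibility of ∂τ − Γ⁻¹E on L², weak formulation.) Assume Γ, E satisfy Hypothesis (S). Then there exists a constant C > 0 such that for every f ∈ L²(ℝ, X) there exists a unique u ∈ L²(ℝ, X) admitting a weak derivative v ∈ L²(ℝ, X) (i.e. ∫_ℝ φ'(t)·u(t) dt = −∫_ℝ φ(t)·v(t) dt for every smooth compactly supported φ : ℝ → ℝ) such that Γ(v(t)) = E(u(t)) + Γ(f(t)) for almost every t ∈ ℝ; moreover ‖u‖_{L²} ≤ C·‖f‖_{L²}. -/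
open MeasureTheory

section WeakDerivative

open SchwartzMap FourierTransform

variable {X : Type*} [NormedAddCommGroup X] [InnerProductSpace ℂ X]

theorem SchwartzMap.integrable_smul_Lp (g : 𝓢(ℝ, ℂ)) (u : Lp X 2 (volume : Measure ℝ)) :
    Integrable (fun t => g t • u t) :=
  memLp_one_iff_integrable.mp ((Lp.memLp u).smul (g.memLp 2 volume))

theorem SchwartzMap.integrable_deriv_smul_Lp (g : 𝓢(ℝ, ℂ)) (u : Lp X 2 (volume : Measure ℝ)) :
    Integrable (fun t => deriv g t • u t) := by
  simpa using (SchwartzMap.derivCLM ℂ ℂ g).integrable_smul_Lp u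

/-- The weak derivative relation against real test functions extends to complex ones. -/
theorem integral_complex_test_of_real {u v : Lp X 2 (volume : Measure ℝ)}
    (h : ∀ φ : ℝ → ℝ, ContDiff ℝ (⊤ : ℕ∞) φ → HasCompactSupport φ →
      ∫ t : ℝ, deriv φ t • u t = -∫ t : ℝ, φ t • v t)
    {ψ : ℝ → ℂ} (hψ : ContDiff ℝ (⊤ : ℕ∞) ψ) (hψc : HasCompactSupport ψ) :
    ∫ t : ℝ, deriv ψ t • u t = -∫ t : ℝ, ψ t • v t := by
  have hd (t : ℝ) : HasDerivAt ψ (deriv ψ t) t :=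
    (hψ.differentiable (by simp) t).hasDerivAt
  have hdre (t : ℝ) : deriv (fun t => (ψ t).re) t = (deriv ψ t).re :=
    (Complex.reCLM.hasFDerivAt.comp_hasDerivAt t (hd t)).deriv
  have hdim (t : ℝ) : deriv (fun t => (ψ t).im) t = (deriv ψ t).im :=
    (Complex.imCLM.hasFDerivAt.comp_hasDerivAt t (hd t)).deriv
  have hre := h (fun t => (ψ t).re) (Complex.reCLM.contDiff.comp hψ) (hψc.comp_left rfl)
  have him := h (fun t => (ψ t).im) (Complex.imCLM.contDiff.comp hψ) (hψc.comp_left rfl)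
  simp only [hdre, hdim] at hre him
  have hsplit {p : ℝ → ℂ} {w : Lp X 2 (volume : Measure ℝ)}
      (hp : Integrable (fun t => p t • w t)) (hpc : Continuous p) :
      ∫ t, p t • w t = (∫ t, (p t).re • w t) + Complex.I • ∫ t, (p t).im • w t := by
    have hdom {q : ℝ → ℝ} (hq : Continuous q) (hle : ∀ t, ‖q t‖ ≤ ‖p t‖) :
        Integrable (fun t => q t • w t) := by
      refine hp.mono (hq.aestronglyMeasurable.smul (Lp.aestronglyMeasurable w)) ?_
      filter_upwards with t
      rw [norm_smul, norm_smul]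
      gcongr
      exact hle t
    rw [← integral_smul, ← integral_add]
    · refine integral_congr_ae (.of_forall fun t => ?_)
      simp only
      rw [← Complex.coe_smul, ← Complex.coe_smul, smul_smul, ← add_smul, mul_comm Complex.I,
        Complex.re_add_im]
    · exact hdom (Complex.continuous_re.comp hpc) fun t => Complex.abs_re_le_norm _
    · exact (hdom (Complex.continuous_im.comp hpc) fun t => Complex.abs_im_le_norm _).smul _
  rw [hsplit (p := deriv ψ) ((hψc.toSchwartzMap hψ).integrable_deriv_smul_Lp u)
      (hψ.continuous_deriv (by simp)),
    hsplit (p := ψ) ((hψc.toSchwartzMap hψ).integrable_smul_Lp v) hψ.continuous, hre, him,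
    smul_neg, neg_add]

/-- The weak derivative relation against compactly supported test functions extends to
Schwartz functions. -/
theorem integral_schwartz_of_real_test {u v : Lp X 2 (volume : Measure ℝ)}
    (h : ∀ φ : ℝ → ℝ, ContDiff ℝ (⊤ : ℕ∞) φ → HasCompactSupport φ →
      ∫ t : ℝ, deriv φ t • u t = -∫ t : ℝ, φ t • v t) (g : 𝓢(ℝ, ℂ)) :
    ∫ t : ℝ, deriv g t • u t = -∫ t : ℝ, g t • v t := by
  let χ : ContDiffBump (0 : ℝ) := ⟨1, 2, by norm_num, by norm_num⟩
  have hχ : ContDiff ℝ (⊤ : ℕ∞) χ := χ.contDiff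
  have hχ' : Continuous (deriv χ) := hχ.continuous_deriv (by simp)
  obtain ⟨K, hK⟩ := χ.hasCompactSupport.deriv.exists_bound_of_continuous hχ'
  have hK0 : 0 ≤ K := (norm_nonneg _).trans (hK 0)
  have hχ1 (t : ℝ) : ‖χ t‖ ≤ 1 := by
    rw [Real.norm_of_nonneg χ.nonneg]
    exact χ.le_one
  let c : ℕ → ℝ := fun n => 1 / ((n : ℝ) + 1)
  have hc0 (n : ℕ) : 0 < c n := Nat.one_div_pos_of_nat
  have hc1 (n : ℕ) : c n ≤ 1 := by
    simpa [c] using Nat.one_div_le_one_div (α := ℝ) (Nat.zero_le n)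
  have hc : Filter.Tendsto c Filter.atTop (nhds 0) := tendsto_one_div_add_atTop_nhds_zero_nat
  have hct (t : ℝ) : Filter.Tendsto (fun n => c n * t) Filter.atTop (nhds 0) := by
    simpa using hc.mul_const t
  let ψ : ℕ → ℝ → ℂ := fun n t => χ (c n * t) • g t
  have hψ (n : ℕ) : ContDiff ℝ (⊤ : ℕ∞) (ψ n) :=
    (hχ.comp (contDiff_const.mul contDiff_id)).smul (g.smooth ⊤)
  have hψc (n : ℕ) : HasCompactSupport (ψ n) := by
    have h1 : HasCompactSupport fun t => χ (c n * t) :=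
      χ.hasCompactSupport.comp_homeomorph (Homeomorph.mulLeft₀ (c n) (hc0 n).ne')
    exact h1.smul_right
  have hdψ (n : ℕ) (t : ℝ) :
      deriv (ψ n) t = χ (c n * t) • deriv g t + (deriv χ (c n * t) * c n) • g t := by
    have h1 : HasDerivAt (fun t => χ (c n * t)) (deriv χ (c n * t) * c n) t := by
      refine HasDerivAt.comp (h₂ := χ) (h := fun t => c n * t) t
        (hχ.differentiable (by simp) _).hasDerivAt ?_
      simpa using (hasDerivAt_id t).const_mul (c n)
    exact (h1.smul (g.differentiable t).hasDerivAt).deriv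
  have hlim1 : Filter.Tendsto (fun n => ∫ t, deriv (ψ n) t • u t) Filter.atTop
      (nhds (∫ t, deriv g t • u t)) := by
    refine tendsto_integral_of_dominated_convergence
      (fun t => ‖deriv g t • u t‖ + K * ‖g t • u t‖) (fun n => ?_) ?_ (fun n => ?_) ?_
    · exact ((hψc n).toSchwartzMap (hψ n)).integrable_deriv_smul_Lp u |>.aestronglyMeasurable
    · exact (g.integrable_deriv_smul_Lp u).norm.add ((g.integrable_smul_Lp u).norm.const_mul K)
    · refine .of_forall fun t => ?_
      rw [hdψ, add_smul, smul_assoc, smul_assoc]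
      refine (norm_add_le _ _).trans (add_le_add ?_ ?_)
      · rw [norm_smul]
        exact mul_le_of_le_one_left (norm_nonneg _) (hχ1 _)
      · rw [norm_smul, norm_mul, Real.norm_of_nonneg (hc0 n).le]
        gcongr
        exact (mul_le_of_le_one_right (norm_nonneg _) (hc1 n)).trans (hK _)
    · refine .of_forall fun t => ?_
      simp only [hdψ]
      have h1 := (χ.continuous.tendsto 0).comp (hct t)
      have h2 := ((hχ'.tendsto 0).comp (hct t)).mul hc
      have h0 : χ 0 = 1 := χ.one_of_mem_closedBall (by simp [χ])
      have := ((h1.smul_const (deriv g t)).add (h2.smul_const (g t))).smul_const (u t)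
      simpa [Function.comp_def, h0] using this
  have hlim2 : Filter.Tendsto (fun n => ∫ t, ψ n t • v t) Filter.atTop
      (nhds (∫ t, g t • v t)) := by
    refine tendsto_integral_of_dominated_convergence
      (fun t => ‖g t • v t‖) (fun n => ?_) (g.integrable_smul_Lp v).norm (fun n => ?_) ?_
    · exact ((hψc n).toSchwartzMap (hψ n)).integrable_smul_Lp v |>.aestronglyMeasurable
    · refine .of_forall fun t => ?_
      simp only [ψ]
      rw [smul_assoc, norm_smul]
      exact mul_le_of_le_one_left (norm_nonneg _) (hχ1 _)
    · refine .of_forall fun t => ?_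
      have h1 := (χ.continuous.tendsto 0).comp (hct t)
      have h0 : χ 0 = 1 := χ.one_of_mem_closedBall (by simp [χ])
      have := (h1.smul_const (g t)).smul_const (v t)
      simpa [Function.comp_def, h0, ψ] using this
  refine tendsto_nhds_unique hlim1 ?_
  simpa only [integral_complex_test_of_real h (hψ _) (hψc _)] using hlim2.neg

variable [CompleteSpace X]

/-- Two `L²` functions defining the same tempered distribution agree. -/
theorem MeasureTheory.Lp.eq_of_integral_schwartz_smul_eq {u v : Lp X 2 (volume : Measure ℝ)}
    (h : ∀ g : 𝓢(ℝ, ℂ), ∫ t, g t • u t = ∫ t, g t • v t) : u = v := by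
  have hker := Lp.ker_toTemperedDistributionCLM_eq_bot (F := X) (μ := (volume : Measure ℝ)) (p := 2)
  refine LinearMap.ker_eq_bot.mp hker ?_
  ext g
  simpa using h g

theorem MeasureTheory.Lp.integral_fourier_smul (g : 𝓢(ℝ, ℂ)) (u : Lp X 2 (volume : Measure ℝ)) :
    ∫ t, (𝓕 g) t • u t = ∫ t, g t • (𝓕 u : Lp X 2 (volume : Measure ℝ)) t := by
  have h := DFunLike.congr_fun (Lp.fourier_toTemperedDistribution_eq u) g
  simpa [TemperedDistribution.fourier_apply] using h

/-- The Fourier transform commutes with bounded operators on the values. -/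
theorem MeasureTheory.Lp.fourier_compLp (A : X →L[ℂ] X) (u : Lp X 2 (volume : Measure ℝ)) :
    𝓕 (A.compLp u) = A.compLp (𝓕 u : Lp X 2 (volume : Measure ℝ)) := by
  have key (g : 𝓢(ℝ, ℂ)) (w : Lp X 2 (volume : Measure ℝ)) :
      ∫ t, g t • (A.compLp w) t = A (∫ t, g t • w t) := by
    rw [← A.integral_comp_comm (g.integrable_smul_Lp w)]
    refine integral_congr_ae ?_
    filter_upwards [A.coeFn_compLp w] with t ht
    simp [ht]
  refine Lp.eq_of_integral_schwartz_smul_eq fun g => ?_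
  rw [← Lp.integral_fourier_smul, key, key, Lp.integral_fourier_smul]

/-- On the Fourier side, the weak derivative tested against Schwartz functions is
multiplication by `2πiω`. -/
theorem MeasureTheory.Lp.schwartz_weakDeriv_iff_fourier {u v : Lp X 2 (volume : Measure ℝ)} :
    (∀ g : 𝓢(ℝ, ℂ), ∫ t, deriv g t • u t = -∫ t, g t • v t) ↔
      ∀ᵐ ω : ℝ, (𝓕 v : Lp X 2 (volume : Measure ℝ)) ω =
        (((2 * Real.pi * ω : ℝ) : ℂ) * Complex.I) • (𝓕 u : Lp X 2 (volume : Measure ℝ)) ω := by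
  have hT : (fun t : ℝ => (inner ℝ t (1 : ℝ) : ℂ)).HasTemperateGrowth := by fun_prop
  have hderiv (g : 𝓢(ℝ, ℂ)) : deriv (𝓕 g : 𝓢(ℝ, ℂ)) =
      fun t => -(𝓕 ((2 * Real.pi * Complex.I) • SchwartzMap.smulLeftCLM ℂ
        (fun t : ℝ => (inner ℝ t (1 : ℝ) : ℂ)) g) : 𝓢(ℝ, ℂ)) t := by
    ext t
    have h := DFunLike.congr_fun (SchwartzMap.lineDerivOp_fourier_eq g (1 : ℝ)) t
    have hR : (fun t : ℝ => inner ℝ t (1 : ℝ)).HasTemperateGrowth := by fun_prop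
    rw [SchwartzMap.lineDerivOp_apply_eq_fderiv, fderiv_apply_one_eq_deriv,
      ← SchwartzMap.smulLeftCLM_ofReal ℂ hR] at h
    rw [h, neg_smul, FourierTransform.fourier_neg]
    rfl
  have hstep (g : 𝓢(ℝ, ℂ)) : ∫ t, deriv (𝓕 g : 𝓢(ℝ, ℂ)) t • u t =
      -∫ ω, g ω • ((((2 * Real.pi * ω : ℝ) : ℂ) * Complex.I) •
        (𝓕 u : Lp X 2 (volume : Measure ℝ)) ω) := by
    rw [hderiv]
    simp only [neg_smul, integral_neg, Lp.integral_fourier_smul]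
    congr 2
    ext ω
    rw [smul_apply, SchwartzMap.smulLeftCLM_apply_apply hT]
    simp only [smul_eq_mul, smul_smul]
    congr 1
    simp
    ring
  constructor
  · intro h
    refine ae_eq_of_integral_contDiff_smul_eq ((Lp.memLp _).locallyIntegrable (by norm_num)) ?_ ?_
    · rw [← locallyIntegrableOn_univ]
      exact LocallyIntegrableOn.continuousOn_smul isOpen_univ.isLocallyClosed
        (locallyIntegrableOn_univ.mpr ((Lp.memLp _).locallyIntegrable (by norm_num)))
        (by fun_prop)
    · intro φ hφ hφc
      have hg₁ : HasCompactSupport (Complex.ofRealCLM ∘ φ) := hφc.comp_left rfl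
      have hg₂ : ContDiff ℝ (⊤ : ℕ∞) (Complex.ofRealCLM ∘ φ) := by fun_prop
      have h1 := h (𝓕 (hg₁.toSchwartzMap hg₂))
      rw [hstep, Lp.integral_fourier_smul, neg_inj] at h1
      simpa using h1.symm
  · intro h g
    obtain ⟨g, rfl⟩ : ∃ g' : 𝓢(ℝ, ℂ), 𝓕 g' = g := ⟨𝓕⁻ g, by simp⟩
    rw [hstep, Lp.integral_fourier_smul]
    congr 1
    refine integral_congr_ae ?_
    filter_upwards [h] with ω hω
    rw [hω]

/-- On the Fourier side, the weak derivative is multiplication by `2πiω`. -/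
theorem MeasureTheory.Lp.weakDeriv_iff_fourier {u v : Lp X 2 (volume : Measure ℝ)} :
    (∀ φ : ℝ → ℝ, ContDiff ℝ (⊤ : ℕ∞) φ → HasCompactSupport φ →
      ∫ t : ℝ, deriv φ t • u t = -∫ t : ℝ, φ t • v t) ↔
      ∀ᵐ ω : ℝ, (𝓕 v : Lp X 2 (volume : Measure ℝ)) ω =
        (((2 * Real.pi * ω : ℝ) : ℂ) * Complex.I) • (𝓕 u : Lp X 2 (volume : Measure ℝ)) ω := by
  rw [← Lp.schwartz_weakDeriv_iff_fourier]
  refine ⟨integral_schwartz_of_real_test, fun h φ hφ hφc => ?_⟩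
  have hg₁ : HasCompactSupport (Complex.ofRealCLM ∘ φ) := hφc.comp_left rfl
  have hg₂ : ContDiff ℝ (⊤ : ℕ∞) (Complex.ofRealCLM ∘ φ) := by fun_prop
  have hd (t : ℝ) : deriv (Complex.ofRealCLM ∘ φ) t = Complex.ofRealCLM (deriv φ t) :=
    (Complex.ofRealCLM.hasFDerivAt.comp_hasDerivAt t
      (hφ.differentiable (by simp) t).hasDerivAt).deriv
  have h1 := h (hg₁.toSchwartzMap hg₂)
  change ∫ t, deriv (Complex.ofRealCLM ∘ φ) t • u t = _ at h1
  simpa [hd] using h1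

/-- The equation `Γ v = E u + Γ f` holds for `L²` functions iff it holds for their Fourier
transforms. -/
theorem MeasureTheory.Lp.operator_equation_iff_fourier (Γ E : X →L[ℂ] X)
    {u v f : Lp X 2 (volume : Measure ℝ)} :
    (∀ᵐ t : ℝ, Γ (v t) = E (u t) + Γ (f t)) ↔
      ∀ᵐ ω : ℝ, Γ ((𝓕 v : Lp X 2 (volume : Measure ℝ)) ω) =
        E ((𝓕 u : Lp X 2 (volume : Measure ℝ)) ω) +
          Γ ((𝓕 f : Lp X 2 (volume : Measure ℝ)) ω) := by
  have key (u v f : Lp X 2 (volume : Measure ℝ)) :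
      (∀ᵐ t : ℝ, Γ (v t) = E (u t) + Γ (f t)) ↔
        Γ.compLp v = E.compLp u + Γ.compLp f := by
    rw [Lp.ext_iff]
    refine Filter.eventually_congr ?_
    filter_upwards [Γ.coeFn_compLp v, E.coeFn_compLp u, Γ.coeFn_compLp f,
      Lp.coeFn_add (E.compLp u) (Γ.compLp f)] with t h1 h2 h3 h4
    rw [h1, h4, Pi.add_apply, h2, h3]
  rw [key, key, ← Lp.fourier_compLp, ← Lp.fourier_compLp, ← Lp.fourier_compLp,
    ← FourierTransform.fourier_add]
  exact (Lp.fourierTransformₗᵢ ℝ X).injective.eq_iff.symm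

end WeakDerivative

/-- A continuous family of bijective operators that is uniformly bounded below can be inverted
pointwise on `L²`. -/
theorem exists_Lp_solution_of_bounded_below
    {X : Type*} [NormedAddCommGroup X] [NormedSpace ℂ X] [CompleteSpace X]
    {A : ℝ → X →L[ℂ] X} (hA : Continuous A) (hbij : ∀ ω, Function.Bijective (A ω))
    {M : ℝ} (hbound : ∀ ω x, ‖x‖ ≤ M * ‖A ω x‖) (g : Lp X 2 (volume : Measure ℝ)) :
    ∃ w : Lp X 2 (volume : Measure ℝ), (∀ᵐ ω : ℝ, A ω (w ω) = g ω) ∧ ‖w‖ ≤ M * ‖g‖ := by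
  have hunit (ω : ℝ) : IsUnit (A ω) := ContinuousLinearMap.isUnit_iff_bijective.mpr (hbij ω)
  have hR : Continuous fun ω => Ring.inverse (A ω) := by
    refine continuous_iff_continuousAt.mpr fun ω => ?_
    obtain ⟨a, ha⟩ := hunit ω
    exact ContinuousAt.comp (ha ▸ NormedRing.inverse_continuousAt a) hA.continuousAt
  have hAR (ω : ℝ) (x : X) : A ω (Ring.inverse (A ω) x) = x :=
    DFunLike.congr_fun (Ring.mul_inverse_cancel (A ω) (hunit ω)) x
  have hle (ω : ℝ) : ‖Ring.inverse (A ω) (g ω)‖ ≤ M * ‖g ω‖ := by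
    simpa [hAR] using hbound ω (Ring.inverse (A ω) (g ω))
  have hmem : MemLp (fun ω => Ring.inverse (A ω) (g ω)) 2 volume :=
    (Lp.memLp g).of_le_mul
      (isBoundedBilinearMap_apply.continuous.comp_aestronglyMeasurable₂ hR.aestronglyMeasurable
        (Lp.aestronglyMeasurable g))
      (.of_forall hle)
  refine ⟨hmem.toLp _, ?_, ?_⟩
  · filter_upwards [hmem.coeFn_toLp] with ω hω
    rw [hω, hAR]
  · refine Lp.norm_le_mul_norm_of_ae_le_mul ?_
    filter_upwards [hmem.coeFn_toLp] with ω hω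
    rw [hω]
    exact hle ω

open scoped FourierTransform

/-- invertibility of `∂τ − Γ⁻¹E` on `L²`, weak formulation.
Under Hypothesis (S) for `Γ, E`, there is `C > 0` such that for every
`f ∈ L²(ℝ, X)` there is a unique `u ∈ L²(ℝ, X)` with a weak derivative
`v ∈ L²(ℝ, X)` satisfying `Γ v = E u + Γ f` a.e.; moreover `‖u‖ ≤ C ‖f‖`. -/
theorem invertibility_cS_on_L2
    {X : Type*} [NormedAddCommGroup X] [InnerProductSpace ℂ X] [CompleteSpace X]
    (Γ E : X →L[ℂ] X)
    (hΓ : IsSelfAdjoint Γ) (hΓinj : Function.Injective Γ)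
    (hE : IsSelfAdjoint E) (hEbij : Function.Bijective E)
    (hbij : ∀ ω : ℝ,
      Function.Bijective ((((2 * Real.pi * ω : ℝ) : ℂ) * Complex.I) • Γ - E))
    (M : ℝ) (hM : 0 < M)
    (hMbound : ∀ (ω : ℝ) (v : X),
      ‖v‖ ≤ M * ‖((((2 * Real.pi * ω : ℝ) : ℂ) * Complex.I) • Γ - E) v‖) :
    ∃ C : ℝ, 0 < C ∧
      ∀ f : Lp X 2 (volume : Measure ℝ),
        ∃ u : Lp X 2 (volume : Measure ℝ),
          (∃ v : Lp X 2 (volume : Measure ℝ),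
            (∀ φ : ℝ → ℝ, ContDiff ℝ (⊤ : ℕ∞) φ → HasCompactSupport φ →
              ∫ t : ℝ, deriv φ t • u t = -∫ t : ℝ, φ t • v t) ∧
            (∀ᵐ t : ℝ, Γ (v t) = E (u t) + Γ (f t))) ∧
          ‖u‖ ≤ C * ‖f‖ ∧
          ∀ u' : Lp X 2 (volume : Measure ℝ),
            (∃ v' : Lp X 2 (volume : Measure ℝ),
              (∀ φ : ℝ → ℝ, ContDiff ℝ (⊤ : ℕ∞) φ → HasCompactSupport φ →
                ∫ t : ℝ, deriv φ t • u' t = -∫ t : ℝ, φ t • v' t) ∧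
              (∀ᵐ t : ℝ, Γ (v' t) = E (u' t) + Γ (f t))) →
            u' = u := by
  set A : ℝ → X →L[ℂ] X := fun ω => (((2 * Real.pi * ω : ℝ) : ℂ) * Complex.I) • Γ - E
  have hA : Continuous A := by fun_prop
  have hAapply (ω : ℝ) (x : X) :
      A ω x = Γ ((((2 * Real.pi * ω : ℝ) : ℂ) * Complex.I) • x) - E x := by
    simp [A]
  refine ⟨M * ‖Γ‖ + 1, by positivity, fun f => ?_⟩
  let f' : Lp X 2 (volume : Measure ℝ) := 𝓕 f
  obtain ⟨w, hw, hwle⟩ := exists_Lp_solution_of_bounded_below hA hbij hMbound (Γ.compLp f')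
  obtain ⟨z, hz, -⟩ := exists_Lp_solution_of_bounded_below hA hbij hMbound (E.compLp f')
  have hwA : ∀ᵐ ω : ℝ, A ω (w ω) = Γ (f' ω) := by
    filter_upwards [hw, Γ.coeFn_compLp f'] with ω h1 h2
    rw [h1, h2]
  have hv : ∀ᵐ ω : ℝ, (f' + z : Lp X 2 (volume : Measure ℝ)) ω =
      (((2 * Real.pi * ω : ℝ) : ℂ) * Complex.I) • w ω := by
    filter_upwards [hwA, hz, E.coeFn_compLp f', Lp.coeFn_add f' z] with ω h1 h2 h3 h4
    apply (hbij ω).1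
    change A ω _ = A ω _
    rw [h4, Pi.add_apply, map_add, h2, h3, map_smul, h1, hAapply, map_smul]
    simp
  refine ⟨𝓕⁻ w, ⟨𝓕⁻ (f' + z), ?_, ?_⟩, ?_, ?_⟩
  · rw [Lp.weakDeriv_iff_fourier, FourierTransform.fourier_fourierInv_eq,
      FourierTransform.fourier_fourierInv_eq]
    exact hv
  · rw [Lp.operator_equation_iff_fourier, FourierTransform.fourier_fourierInv_eq,
      FourierTransform.fourier_fourierInv_eq]
    filter_upwards [hv, hwA] with ω h1 h2
    rw [h1, ← h2, hAapply]
    abel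
  · calc ‖(𝓕⁻ w : Lp X 2 (volume : Measure ℝ))‖ = ‖w‖ := by
          rw [← Lp.norm_fourier_eq, FourierTransform.fourier_fourierInv_eq]
      _ ≤ M * (‖Γ‖ * ‖f‖) := by
          refine hwle.trans ?_
          rw [← Lp.norm_fourier_eq f]
          gcongr
          exact Γ.norm_compLp_le f'
      _ ≤ (M * ‖Γ‖ + 1) * ‖f‖ := by nlinarith [norm_nonneg f]
  · rintro u' ⟨v', hd, heq⟩
    rw [Lp.weakDeriv_iff_fourier] at hd
    rw [Lp.operator_equation_iff_fourier] at heq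
    have : (𝓕 u' : Lp X 2 (volume : Measure ℝ)) = w := by
      refine Lp.ext ?_
      filter_upwards [hd, heq, hwA] with ω h1 h2 h3
      apply (hbij ω).1
      change A ω _ = A ω _
      rw [h3, hAapply, ← h1, h2, add_sub_cancel_left]
    rw [← this, FourierTransform.fourierInv_fourier_eq]
end

section
/- (Weighted convolution estimate.) Let X be a complex Banach space, c > 0, ν > 0, and let W : ℝ → B(X) be a map into the bounded linear operators on X such that τ ↦ W(τ)x is strongly measurable for each x ∈ X and ‖W(τ)‖ ≤ c·e^{−ν|τ|} for all τ ∈ ℝ. Let 0 ≤ α < ν and let f : ℝ → X be strongly measurable with ∫_ℝ e^{2α|s|}‖f(s)‖² ds < ∞. Then for every τ ∈ ℝ the Bochner integral (W∗f)(τ) = ∫_ℝ W(τ − s)(f(s)) ds exists, and ∫_ℝ e^{2α|τ|}‖(W∗f)(τ)‖² dτ ≤ (2c/(ν − α))² · ∫_ℝ e^{2α|s|}‖f(s)‖² ds. -/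
open MeasureTheory

/-- Applying a strongly operator measurable family of operators to a strongly measurable function
gives a strongly measurable function. -/
lemma stronglyMeasurable_clm_apply_of_forall {Ω 𝕜 E F : Type*} [MeasurableSpace Ω]
    [NontriviallyNormedField 𝕜] [NormedAddCommGroup E] [NormedSpace 𝕜 E]
    [NormedAddCommGroup F] [NormedSpace 𝕜 F] {T : Ω → E →L[𝕜] F} {u : Ω → E}
    (hT : ∀ x : E, StronglyMeasurable fun ω => T ω x) (hu : StronglyMeasurable u) :
    StronglyMeasurable fun ω => T ω (u ω) := by
  have simple (g : SimpleFunc Ω E) : StronglyMeasurable fun ω => T ω (g ω) := by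
    induction g using SimpleFunc.induction' with
    | const x => exact hT x
    | @pcw g₁ g₂ s hs h₁ h₂ =>
      have hdec : DecidablePred (· ∈ s) := Classical.decPred _
      convert @StronglyMeasurable.piecewise _ _ _ _ _ _ _ hdec hs h₁ h₂ using 1
      ext ω
      by_cases hω : ω ∈ s <;> simp [hω]
  refine stronglyMeasurable_of_tendsto Filter.atTop (fun n => simple (hu.approx n)) ?_
  exact tendsto_pi_nhds.2 fun ω => ((T ω).continuous.tendsto _).comp (hu.tendsto_approx ω)

/-- The Cauchy–Schwarz inequality with respect to a nonnegative density `k`. -/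
lemma sq_integral_mul_le_integral_mul_integral_mul_sq {Ω : Type*} [MeasurableSpace Ω]
    {μ : Measure Ω} {k g : Ω → ℝ} (hk0 : ∀ ω, 0 ≤ k ω) (hk : Integrable k μ)
    (hkg : Integrable (fun ω => k ω * g ω) μ) (hkg2 : Integrable (fun ω => k ω * g ω ^ 2) μ) :
    (∫ ω, k ω * g ω ∂μ) ^ 2 ≤ (∫ ω, k ω ∂μ) * ∫ ω, k ω * g ω ^ 2 ∂μ := by
  have key (t : ℝ) : 0 ≤ (∫ ω, k ω ∂μ) * (t * t) + (-2 * ∫ ω, k ω * g ω ∂μ) * t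
      + ∫ ω, k ω * g ω ^ 2 ∂μ := by
    have h : 0 ≤ ∫ ω, (k ω * (t * t) + -2 * t * (k ω * g ω) + k ω * g ω ^ 2) ∂μ := by
      refine integral_nonneg fun ω => ?_
      have := mul_nonneg (hk0 ω) (sq_nonneg (t - g ω))
      simp only [Pi.zero_apply]
      linarith
    have hlin : Integrable (fun ω => k ω * (t * t) + -2 * t * (k ω * g ω)) μ :=
      (hk.mul_const _).add (hkg.const_mul _)
    rw [integral_add hlin hkg2,
      integral_add (hk.mul_const _) (hkg.const_mul _), integral_mul_const,
      integral_const_mul] at h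
    linarith
  have := discrim_le_zero key
  rw [discrim] at this
  linarith

lemma integral_exp_neg_mul_abs {b : ℝ} (hb : 0 < b) : ∫ t : ℝ, Real.exp (-b * |t|) = 2 / b := by
  rw [integral_comp_abs (f := fun t => Real.exp (-b * t)), integral_exp_mul_Ioi (by linarith)]
  simp
  ring

lemma integrable_exp_neg_mul_abs {b : ℝ} (hb : 0 < b) :
    Integrable fun t : ℝ => Real.exp (-b * |t|) :=
  .of_integral_ne_zero (by rw [integral_exp_neg_mul_abs hb]; positivity)

/-- weighted convolution estimate. Let `X` be a complex Banach
space, `W : ℝ → B(X)` strongly measurable with `‖W(τ)‖ ≤ c·e^{−ν|τ|}`, `0 ≤ α < ν`,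
and `f` strongly measurable with `∫ e^{2α|s|}‖f s‖² ds < ∞`. Then the convolution
`(W∗f)(τ) = ∫ W(τ−s)(f s) ds` exists for every `τ`, and
`∫ e^{2α|τ|}‖(W∗f)(τ)‖² dτ ≤ (2c/(ν−α))² ∫ e^{2α|s|}‖f s‖² ds`. -/
theorem weighted_convolution_estimate
    {X : Type*} [NormedAddCommGroup X] [NormedSpace ℂ X] [CompleteSpace X]
    (c ν α : ℝ) (hc : 0 < c) (hν : 0 < ν) (hα0 : 0 ≤ α) (hαν : α < ν)
    (W : ℝ → (X →L[ℂ] X))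
    (hWmeas : ∀ x : X, StronglyMeasurable fun τ : ℝ => W τ x)
    (hWbound : ∀ τ : ℝ, ‖W τ‖ ≤ c * Real.exp (-ν * |τ|))
    (f : ℝ → X) (hfmeas : StronglyMeasurable f)
    (hf : Integrable (fun s : ℝ => Real.exp (2 * α * |s|) * ‖f s‖ ^ 2)) :
    (∀ τ : ℝ, Integrable fun s : ℝ => (W (τ - s)) (f s)) ∧
    Integrable
      (fun τ : ℝ => Real.exp (2 * α * |τ|) * ‖∫ s : ℝ, (W (τ - s)) (f s)‖ ^ 2) ∧
    ∫ τ : ℝ, Real.exp (2 * α * |τ|) * ‖∫ s : ℝ, (W (τ - s)) (f s)‖ ^ 2 ≤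
      (2 * c / (ν - α)) ^ 2 * ∫ s : ℝ, Real.exp (2 * α * |s|) * ‖f s‖ ^ 2 := by
  have hβ : 0 < ν - α := sub_pos.2 hαν
  set k : ℝ → ℝ := fun t => c * Real.exp (-(ν - α) * |t|) with hk_def
  set g : ℝ → ℝ := fun s => Real.exp (α * |s|) * ‖f s‖ with hg_def
  have hk0 (t : ℝ) : 0 ≤ k t := by positivity
  have hk : Integrable k := (integrable_exp_neg_mul_abs hβ).const_mul c
  have hkint : ∫ t, k t = 2 * c / (ν - α) := by
    rw [hk_def, integral_const_mul, integral_exp_neg_mul_abs hβ]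
    ring
  have hkc (t : ℝ) : k t ≤ c := by
    refine mul_le_of_le_one_right hc.le (Real.exp_le_one_iff.2 ?_)
    have := mul_nonneg hβ.le (abs_nonneg t)
    linarith
  have hkcont : Continuous k := by fun_prop
  have hgmeas : StronglyMeasurable g :=
    (by fun_prop : Continuous fun s : ℝ => Real.exp (α * |s|)).stronglyMeasurable.mul hfmeas.norm
  have hg0 (s : ℝ) : 0 ≤ g s := by positivity
  have exp_sq (s : ℝ) : Real.exp (2 * α * |s|) = Real.exp (α * |s|) ^ 2 := by
    rw [sq, ← Real.exp_add]
    ring_nf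
  have hg2 (s : ℝ) : Real.exp (2 * α * |s|) * ‖f s‖ ^ 2 = g s ^ 2 := by
    rw [exp_sq, hg_def, mul_pow]
  simp_rw [hg2] at hf ⊢
  have hkτ (τ : ℝ) : Integrable fun s => k (τ - s) := hk.comp_sub_left τ
  have hkτmeas (τ : ℝ) : StronglyMeasurable fun s => k (τ - s) :=
    (hkcont.comp (continuous_sub_left τ)).stronglyMeasurable
  have hkg2 (τ : ℝ) : Integrable fun s => k (τ - s) * g s ^ 2 := by
    refine (hf.const_mul c).mono' ((hkτmeas τ).mul (hgmeas.pow 2)).aestronglyMeasurable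
      (.of_forall fun s => ?_)
    rw [Real.norm_of_nonneg (mul_nonneg (hk0 _) (sq_nonneg _))]
    exact mul_le_mul_of_nonneg_right (hkc _) (sq_nonneg _)
  have hkg (τ : ℝ) : Integrable fun s => k (τ - s) * g s := by
    refine ((hkτ τ).add (hkg2 τ)).mono' ((hkτmeas τ).mul hgmeas).aestronglyMeasurable
      (.of_forall fun s => ?_)
    rw [Real.norm_of_nonneg (mul_nonneg (hk0 _) (hg0 _))]
    simp only [Pi.add_apply]
    nlinarith [mul_nonneg (hk0 (τ - s)) (sq_nonneg (g s - 1)),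
      mul_nonneg (hk0 (τ - s)) (sq_nonneg (g s)), hk0 (τ - s)]
  have bound (τ s : ℝ) : Real.exp (α * |τ|) * ‖W (τ - s) (f s)‖ ≤ k (τ - s) * g s := by
    have hexp : Real.exp (α * |τ|) * Real.exp (-ν * |τ - s|)
        ≤ Real.exp (-(ν - α) * |τ - s|) * Real.exp (α * |s|) := by
      rw [← Real.exp_add, ← Real.exp_add, Real.exp_le_exp]
      have htri : |τ| ≤ |τ - s| + |s| := by simpa using abs_add_le (τ - s) s
      nlinarith [mul_le_mul_of_nonneg_left htri hα0]
    calc Real.exp (α * |τ|) * ‖W (τ - s) (f s)‖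
        ≤ Real.exp (α * |τ|) * (c * Real.exp (-ν * |τ - s|) * ‖f s‖) := by
          gcongr
          exact (W (τ - s)).le_of_opNorm_le (hWbound _) _
      _ = c * ‖f s‖ * (Real.exp (α * |τ|) * Real.exp (-ν * |τ - s|)) := by ring
      _ ≤ c * ‖f s‖ * (Real.exp (-(ν - α) * |τ - s|) * Real.exp (α * |s|)) := by gcongr
      _ = k (τ - s) * g s := by simp only [hk_def, hg_def]; ring
  have hjoint : StronglyMeasurable fun p : ℝ × ℝ => W (p.1 - p.2) (f p.2) :=
    stronglyMeasurable_clm_apply_of_forall (T := fun p : ℝ × ℝ => W (p.1 - p.2))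
      (fun x => (hWmeas x).comp_measurable (measurable_fst.sub measurable_snd))
      (hfmeas.comp_measurable measurable_snd)
  have hint (τ : ℝ) : Integrable fun s => W (τ - s) (f s) := by
    refine (hkg τ).mono' (hjoint.comp_measurable measurable_prodMk_left).aestronglyMeasurable
      (.of_forall fun s => (le_mul_of_one_le_left (norm_nonneg _) ?_).trans (bound τ s))
    exact Real.one_le_exp (by positivity)
  have pointwise (τ : ℝ) : Real.exp (2 * α * |τ|) * ‖∫ s, W (τ - s) (f s)‖ ^ 2
      ≤ 2 * c / (ν - α) * ∫ s, k (τ - s) * g s ^ 2 := by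
    have hle : Real.exp (α * |τ|) * ‖∫ s, W (τ - s) (f s)‖ ≤ ∫ s, k (τ - s) * g s :=
      calc Real.exp (α * |τ|) * ‖∫ s, W (τ - s) (f s)‖
          ≤ Real.exp (α * |τ|) * ∫ s, ‖W (τ - s) (f s)‖ := by
            gcongr
            exact norm_integral_le_integral_norm _
        _ = ∫ s, Real.exp (α * |τ|) * ‖W (τ - s) (f s)‖ := (integral_const_mul _ _).symm
        _ ≤ ∫ s, k (τ - s) * g s :=
            integral_mono ((hint τ).norm.const_mul _) (hkg τ) (bound τ)
    calc Real.exp (2 * α * |τ|) * ‖∫ s, W (τ - s) (f s)‖ ^ 2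
        = (Real.exp (α * |τ|) * ‖∫ s, W (τ - s) (f s)‖) ^ 2 := by rw [exp_sq, mul_pow]
      _ ≤ (∫ s, k (τ - s) * g s) ^ 2 := by gcongr
      _ ≤ (∫ s, k (τ - s)) * ∫ s, k (τ - s) * g s ^ 2 :=
          sq_integral_mul_le_integral_mul_integral_mul_sq (fun s => hk0 (τ - s)) (hkτ τ) (hkg τ)
            (hkg2 τ)
      _ = 2 * c / (ν - α) * ∫ s, k (τ - s) * g s ^ 2 := by
          rw [integral_sub_left_eq_self k volume τ, hkint]
  have hconv_eq : convolution (fun s => g s ^ 2) k (ContinuousLinearMap.mul ℝ ℝ) volume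
      = fun τ => ∫ s, k (τ - s) * g s ^ 2 := by
    ext τ
    simp only [convolution, ContinuousLinearMap.mul_apply', mul_comm]
  have hconv : Integrable fun τ => ∫ s, k (τ - s) * g s ^ 2 :=
    hconv_eq ▸ hf.integrable_convolution (ContinuousLinearMap.mul ℝ ℝ) hk
  have hconv_int : ∫ τ, ∫ s, k (τ - s) * g s ^ 2 = (∫ s, g s ^ 2) * (2 * c / (ν - α)) := by
    rw [← hconv_eq, integral_convolution (ContinuousLinearMap.mul ℝ ℝ) hf hk, hkint,
      ContinuousLinearMap.mul_apply']
  have hWf : Integrable fun τ => Real.exp (2 * α * |τ|) * ‖∫ s, W (τ - s) (f s)‖ ^ 2 := by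
    refine (hconv.const_mul (2 * c / (ν - α))).mono'
      (StronglyMeasurable.aestronglyMeasurable ?_) (.of_forall fun τ => ?_)
    · exact (by fun_prop : Continuous fun τ : ℝ => Real.exp (2 * α * |τ|)).stronglyMeasurable.mul
        (hjoint.integral_prod_right.norm.pow 2)
    · rw [Real.norm_of_nonneg (by positivity)]
      exact pointwise τ
  refine ⟨hint, hWf, (integral_mono hWf (hconv.const_mul _) pointwise).trans_eq ?_⟩
  rw [integral_const_mul, hconv_int]
  ring
end

section
/- (Unboundedness of the resolvent Fourier multiplier on L^∞; the ℓ² example.) For each integer n ≥ 1 define F_n : ℝ → ℝ by F_n(τ) = eⁿ·exp(eⁿτ) for τ < 0 and F_n(τ) = 0 for τ ≥ 0, and let g_n : ℝ → ℝ be the indicator function of the interval [e^{−(n+1)}, e^{−n}). Then: (a) Σ_{n≥1} g_n(τ)² ≤ 1 for every τ ∈ ℝ; (b) for every n ≥ 1 and every τ ∈ [0, e^{−(n+1)}), ∫_ℝ F_n(τ − s)·g_n(s) ds = (e^{−1/e} − e^{−1})·exp(eⁿτ); (c) consequently, for every m ≥ 1 and every τ ∈ [0, e^{−(m+1)}), Σ_{n=1}^{m}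 (∫_ℝ F_n(τ − s)·g_n(s) ds)² ≥ m·(e^{−1/e} − e^{−1})², so that for every M > 0 there exists τ > 0 with Σ_{n≥1} (∫_ℝ F_n(τ − s)·g_n(s) ds)² ≥ M; in particular the function τ ↦ ((F_n ∗ g_n)(τ))_{n≥1} is not essentially bounded as an ℓ²-valued function on (0, ∞), even though (g_n(τ))_{n≥1} is bounded in ℓ² uniformly in τ. -/
open MeasureTheory

/-- The kernel `F_n(τ) = eⁿ·exp(eⁿτ)` for `τ < 0`, `F_n(τ) = 0` for `τ ≥ 0`. -/
noncomputable def expKernel (n : ℕ) (τ : ℝ) : ℝ :=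
  if τ < 0 then Real.exp (n : ℝ) * Real.exp (Real.exp (n : ℝ) * τ) else 0

/-- The indicator `g_n` of the interval `[e^{−(n+1)}, e^{−n})`. -/
noncomputable def boxFn (n : ℕ) (τ : ℝ) : ℝ :=
  Set.indicator (Set.Ico (Real.exp (-((n : ℝ) + 1))) (Real.exp (-(n : ℝ)))) (fun _ => 1) τ

/-- At most one of the intervals `[e^{−(n+1)}, e^{−n})` contains a given point. -/
lemma eq_of_boxFn_ne_zero {m n : ℕ} {τ : ℝ} (hm : boxFn m τ ≠ 0) (hn : boxFn n τ ≠ 0) :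
    m = n := by
  have hm' := Set.mem_of_indicator_ne_zero hm
  have hn' := Set.mem_of_indicator_ne_zero hn
  have h₁ := Real.exp_lt_exp.mp (hm'.1.trans_lt hn'.2)
  have h₂ := Real.exp_lt_exp.mp (hn'.1.trans_lt hm'.2)
  have h₃ : n < m + 1 := by
    have : (n : ℝ) < (m : ℝ) + 1 := by linarith
    exact_mod_cast this
  have h₄ : m < n + 1 := by
    have : (m : ℝ) < (n : ℝ) + 1 := by linarith
    exact_mod_cast this
  omega

lemma boxFn_sq_le_one (n : ℕ) (τ : ℝ) : boxFn n τ ^ 2 ≤ 1 := by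
  by_cases h : τ ∈ Set.Ico (Real.exp (-((n : ℝ) + 1))) (Real.exp (-(n : ℝ)))
  · rw [boxFn, Set.indicator_of_mem h, one_pow]
  · rw [boxFn, Set.indicator_of_notMem h, zero_pow two_ne_zero]
    exact zero_le_one

lemma tsum_boxFn_sq_le_one (τ : ℝ) : ∑' n : ℕ, boxFn (n + 1) τ ^ 2 ≤ 1 := by
  by_cases h : ∃ n : ℕ, boxFn (n + 1) τ ≠ 0
  · obtain ⟨n, hn⟩ := h
    rw [tsum_eq_single n]
    · exact boxFn_sq_le_one _ _
    · intro k hk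
      by_contra hne
      have := eq_of_boxFn_ne_zero (pow_ne_zero_iff two_ne_zero |>.mp hne) hn
      omega
  · push Not at h
    simp [h]

lemma integral_expKernel_mul_boxFn (n : ℕ) {τ : ℝ} (hτ : τ < Real.exp (-((n : ℝ) + 1))) :
    ∫ s : ℝ, expKernel n (τ - s) * boxFn n s =
      (Real.exp (-(Real.exp 1)⁻¹) - Real.exp (-1)) * Real.exp (Real.exp (n : ℝ) * τ) := by
  set a := Real.exp (-((n : ℝ) + 1)) with ha
  set b := Real.exp (-(n : ℝ)) with hb
  set c := Real.exp (n : ℝ) with hc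
  have hab : a ≤ b := Real.exp_le_exp.mpr (by linarith)
  have hca : c * a = (Real.exp 1)⁻¹ := by
    rw [ha, hc, ← Real.exp_add, ← Real.exp_neg]
    congr 1
    ring
  have hcb : c * b = 1 := by
    rw [hb, hc, ← Real.exp_add, add_neg_cancel, Real.exp_zero]
  have hfun : (fun s : ℝ => expKernel n (τ - s) * boxFn n s) =
      (Set.Ico a b).indicator fun s => c * Real.exp (c * (τ - s)) := by
    funext s
    by_cases hs : s ∈ Set.Ico a b
    · have hlt : τ - s < 0 := by linarith [hs.1]
      rw [Set.indicator_of_mem hs, boxFn, Set.indicator_of_mem hs, expKernel, if_pos hlt, mul_one]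
    · rw [Set.indicator_of_notMem hs, boxFn, Set.indicator_of_notMem hs, mul_zero]
  have hderiv (s : ℝ) :
      HasDerivAt (fun s => -Real.exp (c * (τ - s))) (c * Real.exp (c * (τ - s))) s :=
    (((hasDerivAt_id' s).const_sub τ).const_mul c).exp.neg.congr_deriv (by ring)
  rw [hfun, integral_indicator measurableSet_Ico, integral_Ico_eq_integral_Ioc,
    ← intervalIntegral.integral_of_le hab,
    intervalIntegral.integral_eq_sub_of_hasDerivAt (fun s _ => hderiv s)
      (Continuous.intervalIntegrable (by fun_prop) _ _),
    mul_sub, mul_sub, hca, hcb, sub_eq_add_neg (c * τ), sub_eq_add_neg (c * τ), Real.exp_add,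
    Real.exp_add]
  ring

lemma integral_expKernel_mul_boxFn_eq_zero {n : ℕ} {τ : ℝ} (hτ : Real.exp (-(n : ℝ)) ≤ τ) :
    ∫ s : ℝ, expKernel n (τ - s) * boxFn n s = 0 := by
  refine integral_eq_zero_of_ae (Filter.Eventually.of_forall fun s => ?_)
  by_cases hs : s ∈ Set.Ico (Real.exp (-((n : ℝ) + 1))) (Real.exp (-(n : ℝ)))
  · have h : ¬ τ - s < 0 := by linarith [hs.2]
    simp [expKernel, h]
  · simp only [boxFn, Set.indicator_of_notMem hs, mul_zero, Pi.zero_apply]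

lemma summable_sq_integral_expKernel_mul_boxFn {τ : ℝ} (hτ : 0 < τ) :
    Summable fun n : ℕ => (∫ s : ℝ, expKernel (n + 1) (τ - s) * boxFn (n + 1) s) ^ 2 := by
  obtain ⟨N, hN⟩ := exists_nat_ge (-Real.log τ)
  refine summable_of_ne_finset_zero (s := Finset.range N) fun n hn => ?_
  have hNn : (N : ℝ) ≤ n := by
    exact_mod_cast not_lt.mp (Finset.mem_range.not.mp hn)
  rw [integral_expKernel_mul_boxFn_eq_zero, zero_pow two_ne_zero]
  rw [← Real.le_log_iff_exp_le hτ]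
  push_cast
  linarith

lemma mul_sq_le_sum_sq_integral_expKernel_mul_boxFn (m : ℕ) {τ : ℝ} (h₀ : 0 ≤ τ)
    (hτ : τ < Real.exp (-((m : ℝ) + 1))) :
    (m : ℝ) * (Real.exp (-(Real.exp 1)⁻¹) - Real.exp (-1)) ^ 2 ≤
      ∑ n ∈ Finset.Icc 1 m, (∫ s : ℝ, expKernel n (τ - s) * boxFn n s) ^ 2 := by
  have hterm : ∀ n ∈ Finset.Icc 1 m, (Real.exp (-(Real.exp 1)⁻¹) - Real.exp (-1)) ^ 2 ≤
      (∫ s : ℝ, expKernel n (τ - s) * boxFn n s) ^ 2 := by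
    intro n hn
    have hnm : (n : ℝ) ≤ m := by exact_mod_cast (Finset.mem_Icc.mp hn).2
    rw [integral_expKernel_mul_boxFn n
      (hτ.trans_le (Real.exp_le_exp.mpr (by linarith))), mul_pow]
    exact le_mul_of_one_le_right (sq_nonneg _)
      (one_le_pow₀ (Real.one_le_exp (mul_nonneg (Real.exp_nonneg _) h₀)))
  simpa using Finset.card_nsmul_le_sum _ _ _ hterm

lemma exists_le_tsum_sq_integral_expKernel_mul_boxFn (M : ℝ) :
    ∃ τ : ℝ, 0 < τ ∧
      M ≤ ∑' n : ℕ, (∫ s : ℝ, expKernel (n + 1) (τ - s) * boxFn (n + 1) s) ^ 2 := by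
  have hpos : 0 < (Real.exp (-(Real.exp 1)⁻¹) - Real.exp (-1)) ^ 2 := by
    refine pow_pos (sub_pos.mpr (Real.exp_lt_exp.mpr (neg_lt_neg ?_))) 2
    exact inv_lt_one_of_one_lt₀ (Real.one_lt_exp_iff.mpr one_pos)
  obtain ⟨m, hm⟩ := exists_nat_ge (M / (Real.exp (-(Real.exp 1)⁻¹) - Real.exp (-1)) ^ 2)
  obtain ⟨τ, h₀, hτ⟩ := exists_between (Real.exp_pos (-((m : ℝ) + 1)))
  refine ⟨τ, h₀, ?_⟩
  calc
    M ≤ m * (Real.exp (-(Real.exp 1)⁻¹) - Real.exp (-1)) ^ 2 := (div_le_iff₀ hpos).mp hm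
    _ ≤ ∑ n ∈ Finset.Icc 1 m, (∫ s : ℝ, expKernel n (τ - s) * boxFn n s) ^ 2 :=
      mul_sq_le_sum_sq_integral_expKernel_mul_boxFn m h₀.le hτ
    _ = ∑ n ∈ Finset.range m, (∫ s : ℝ, expKernel (n + 1) (τ - s) * boxFn (n + 1) s) ^ 2 := by
      rw [Finset.range_eq_Ico,
        Finset.sum_Ico_add' (fun n : ℕ => (∫ s : ℝ, expKernel n (τ - s) * boxFn n s) ^ 2) 0 m 1]
      rfl
    _ ≤ _ := (summable_sq_integral_expKernel_mul_boxFn h₀).sum_le_tsum _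
      fun _ _ => sq_nonneg _

/-- unboundedness of the resolvent multiplier on `L^∞`; the `ℓ²`
example. (a) `Σ_{n≥1} g_n(τ)² ≤ 1` for every `τ`; (b) for `n ≥ 1` and
`τ ∈ [0, e^{−(n+1)})`, `(F_n ∗ g_n)(τ) = (e^{−1/e} − e^{−1})·exp(eⁿτ)`;
(c) for `m ≥ 1` and `τ ∈ [0, e^{−(m+1)})`,
`Σ_{n=1}^m (F_n ∗ g_n)(τ)² ≥ m·(e^{−1/e} − e^{−1})²`, so for every `M > 0` there is
`τ > 0` with `Σ_{n≥1} (F_n ∗ g_n)(τ)² ≥ M`. -/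
theorem resolvent_multiplier_not_Linfty_bounded :
    (∀ τ : ℝ, ∑' n : ℕ, (boxFn (n + 1) τ) ^ 2 ≤ 1) ∧
    (∀ n : ℕ, 1 ≤ n → ∀ τ : ℝ, 0 ≤ τ → τ < Real.exp (-((n : ℝ) + 1)) →
      ∫ s : ℝ, expKernel n (τ - s) * boxFn n s =
        (Real.exp (-(Real.exp 1)⁻¹) - Real.exp (-1)) * Real.exp (Real.exp (n : ℝ) * τ)) ∧
    (∀ m : ℕ, 1 ≤ m → ∀ τ : ℝ, 0 ≤ τ → τ < Real.exp (-((m : ℝ) + 1)) →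
      (m : ℝ) * (Real.exp (-(Real.exp 1)⁻¹) - Real.exp (-1)) ^ 2 ≤
        ∑ n ∈ Finset.Icc 1 m, (∫ s : ℝ, expKernel n (τ - s) * boxFn n s) ^ 2) ∧
    (∀ M : ℝ, 0 < M → ∃ τ : ℝ, 0 < τ ∧
      M ≤ ∑' n : ℕ, (∫ s : ℝ, expKernel (n + 1) (τ - s) * boxFn (n + 1) s) ^ 2) := by
  exact ⟨tsum_boxFn_sq_le_one, fun n _ _ _ hτ => integral_expKernel_mul_boxFn n hτ,
    fun m _ _ h₀ hτ => mul_sq_le_sum_sq_integral_expKernel_mul_boxFn m h₀ hτ,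
    fun M _ => exists_le_tsum_sq_integral_expKernel_mul_boxFn M⟩
end
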